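/- There is an absolute constant such that the following holds: for all integers n ≥ 2 and all prime powers q, if A is a subset of G = PSL(n,q) with |A| ≥ 2|G|/q^{(n-1)/3}, then A³ = G. -/

import Mathlib

open scoped MatrixGroups Pointwise

/-- The linear operator of a complex matrix on Euclidean space has an extremal singular value whose
multiplicity is controlled by the Hilbert–Schmidt norm. -/
theorem Matrix.exists_extremal_eigenspace {ι : Type*} [Fintype ι] [DecidableEq ι] [Nonempty ι]
    (M : Matrix ι ι ℂ) :
    ∃ μ : ℝ, 0 ≤ μ ∧
      (∀ x : EuclideanSpace ℂ ι, ‖M.toEuclideanLin x‖ ^ 2 ≤ μ * ‖x‖ ^ 2) ∧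
      Module.End.HasEigenvalue (M.conjTranspose * M).toEuclideanLin (μ : ℂ) ∧
      Module.finrank ℂ (Module.End.eigenspace (M.conjTranspose * M).toEuclideanLin (μ : ℂ)) * μ ≤
        ∑ i, ∑ j, ‖M i j‖ ^ 2 := by
  set S := (M.conjTranspose * M).toEuclideanLin with hS
  have hSM (x y : EuclideanSpace ℂ ι) :
      inner ℂ (S x) y = inner ℂ (M.toEuclideanLin x) (M.toEuclideanLin y) := by
    rw [hS, Matrix.toLpLin_mul_same, LinearMap.comp_apply,
      Matrix.toEuclideanLin_conjTranspose_eq_adjoint, LinearMap.adjoint_inner_left]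
  have hsym : S.IsSymmetric := Matrix.isSymmetric_toEuclideanLin_iff.2
    (Matrix.isHermitian_conjTranspose_mul_self M)
  have hre (x : EuclideanSpace ℂ ι) :
      RCLike.re (inner ℂ (S x) x) = ‖M.toEuclideanLin x‖ ^ 2 := by
    rw [hSM, inner_self_eq_norm_sq]
  have heig := hsym.hasEigenvalue_iSup_of_finiteDimensional
  set μ : ℝ := ⨆ x : { x : EuclideanSpace ℂ ι // x ≠ 0 },
    RCLike.re (inner ℂ (S x) x) / ‖(x : EuclideanSpace ℂ ι)‖ ^ 2 with hμ
  have hbdd : BddAbove (Set.range fun x : { x : EuclideanSpace ℂ ι // x ≠ 0 } ↦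
      RCLike.re (inner ℂ (S x) x) / ‖(x : EuclideanSpace ℂ ι)‖ ^ 2) := by
    refine ⟨‖M.toEuclideanLin.toContinuousLinearMap‖ ^ 2, ?_⟩
    rintro _ ⟨x, rfl⟩
    have hx : 0 < ‖(x : EuclideanSpace ℂ ι)‖ := norm_pos_iff.2 x.2
    dsimp only
    rw [hre, div_le_iff₀ (by positivity), ← mul_pow]
    gcongr
    exact M.toEuclideanLin.toContinuousLinearMap.le_opNorm x
  have hle (x : EuclideanSpace ℂ ι) : ‖M.toEuclideanLin x‖ ^ 2 ≤ μ * ‖x‖ ^ 2 := by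
    rcases eq_or_ne x 0 with rfl | hx
    · simp
    · have hx' : 0 < ‖x‖ := norm_pos_iff.2 hx
      rw [← div_le_iff₀ (by positivity), ← hre]
      exact le_ciSup hbdd ⟨x, hx⟩
  have hμ0 : 0 ≤ μ := by
    rw [hμ]
    exact Real.iSup_nonneg fun x ↦ by rw [hre]; positivity
  refine ⟨μ, hμ0, hle, heig, ?_⟩
  set E := Module.End.eigenspace S (μ : ℂ)
  let e := stdOrthonormalBasis ℂ E
  have he : Orthonormal ℂ (fun k ↦ (e k : EuclideanSpace ℂ ι)) :=
    e.orthonormal.comp_linearIsometry E.subtypeₗᵢ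
  have hnorm (k) : ‖M.toEuclideanLin (e k)‖ ^ 2 = μ := by
    have h1 : S (e k) = (μ : ℂ) • (e k : EuclideanSpace ℂ ι) :=
      Module.End.mem_eigenspace_iff.1 (e k).2
    rw [← hre, h1, inner_smul_left, inner_self_eq_norm_sq_to_K, he.1 k]
    simp
  calc (Module.finrank ℂ E : ℝ) * μ = ∑ k, ‖M.toEuclideanLin (e k)‖ ^ 2 := by simp [hnorm]
    _ = ∑ i, ∑ k, ‖inner ℂ (e k : EuclideanSpace ℂ ι) (WithLp.toLp 2 (star (M i)))‖ ^ 2 := by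
      simp_rw [EuclideanSpace.norm_sq_eq]
      rw [Finset.sum_comm]
      refine Finset.sum_congr rfl fun i _ ↦ Finset.sum_congr rfl fun k _ ↦ ?_
      rw [norm_inner_symm, EuclideanSpace.inner_eq_star_dotProduct]
      simp [Matrix.toLpLin_apply, Matrix.mulVec, dotProduct_comm]
    _ ≤ ∑ i, ‖(WithLp.toLp 2 (star (M i)) : EuclideanSpace ℂ ι)‖ ^ 2 :=
      Finset.sum_le_sum fun i _ ↦ he.sum_inner_products_le _
    _ = ∑ i, ∑ j, ‖M i j‖ ^ 2 := by simp [EuclideanSpace.norm_sq_eq]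

/-- Left translation of functions on a finite group, as a representation. -/
def leftTranslation (G : Type*) [Group G] : Representation ℂ G (EuclideanSpace ℂ G) where
  toFun g :=
    { toFun := fun f ↦ WithLp.toLp 2 fun x ↦ f (g⁻¹ * x)
      map_add' := fun _ _ ↦ rfl
      map_smul' := fun _ _ ↦ rfl }
  map_one' := by ext; simp
  map_mul' g h := by
    refine LinearMap.ext fun f ↦ ?_
    ext x
    change f _ = f _
    simp [mul_assoc]

lemma leftTranslation_apply {G : Type*} [Group G] (g x : G) (f : EuclideanSpace ℂ G) :
    leftTranslation G g f x = f (g⁻¹ * x) := rfl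

lemma leftTranslation_commute {G : Type*} [Group G] [Fintype G] [DecidableEq G]
    {P : Matrix G G ℂ} (hP : ∀ g x y, P (g * x) (g * y) = P x y) (g : G)
    (f : EuclideanSpace ℂ G) :
    P.toEuclideanLin (leftTranslation G g f) = leftTranslation G g (P.toEuclideanLin f) := by
  ext x
  rw [leftTranslation_apply]
  simp only [Matrix.toLpLin_apply, Matrix.mulVec, dotProduct, leftTranslation_apply]
  refine Fintype.sum_equiv (Equiv.mulLeft g⁻¹) _ _ fun y ↦ ?_
  rw [Equiv.coe_mulLeft, hP]

/-- The restriction of a representation to an invariant subspace. -/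
def Representation.restrictInvariant {k G V : Type*} [CommSemiring k] [Monoid G]
    [AddCommMonoid V] [Module k V] (ρ : Representation k G V) (E : Submodule k V)
    (hE : ∀ g, ∀ v ∈ E, ρ g v ∈ E) : Representation k G E where
  toFun g := (ρ g).restrict (hE g)
  map_one' := by ext; simp
  map_mul' g h := by ext; simp

/-- A convolution operator annihilating the constants has small norm on a quasirandom group. -/
theorem convolution_norm_bound {G : Type} [Group G] [Fintype G] [DecidableEq G] {D : ℝ}
    (hD : ∀ (E : Type) [AddCommGroup E] [Module ℂ E] [FiniteDimensional ℂ E]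
      (ρ : Representation ℂ G E), ρ ≠ 1 → D ≤ Module.finrank ℂ E)
    (b : G → ℂ) (hb : ∑ x, b x = 0) :
    ∃ μ : ℝ, 0 ≤ μ ∧ D * μ ≤ Fintype.card G * ∑ x, ‖b x‖ ^ 2 ∧
      ∀ f : EuclideanSpace ℂ G,
        ‖(Matrix.of fun x y ↦ b (y⁻¹ * x)).toEuclideanLin f‖ ^ 2 ≤ μ * ‖f‖ ^ 2 := by
  set M : Matrix G G ℂ := Matrix.of fun x y ↦ b (y⁻¹ * x) with hM
  obtain ⟨μ, hμ0, hle, heig, hdim⟩ := M.exists_extremal_eigenspace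
  refine ⟨μ, hμ0, ?_, hle⟩
  have hHS : ∑ x, ∑ y, ‖M x y‖ ^ 2 = Fintype.card G * ∑ x, ‖b x‖ ^ 2 := by
    rw [Finset.sum_comm]
    calc ∑ y, ∑ x, ‖M x y‖ ^ 2 = ∑ _y : G, ∑ x, ‖b x‖ ^ 2 :=
          Finset.sum_congr rfl fun y _ ↦
            Fintype.sum_equiv (Equiv.mulLeft y⁻¹) _ _ fun x ↦ rfl
      _ = _ := by simp
  rw [hHS] at hdim
  rcases hμ0.eq_or_lt with h0 | hpos
  · rw [← h0, mul_zero]; positivity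
  refine le_trans (mul_le_mul_of_nonneg_right ?_ hμ0) hdim
  have hMinv (g x y : G) : M (g * x) (g * y) = M x y := by simp [hM, mul_assoc]
  have hPinv (g x y : G) :
      (M.conjTranspose * M) (g * x) (g * y) = (M.conjTranspose * M) x y := by
    simp only [Matrix.mul_apply, Matrix.conjTranspose_apply]
    refine (Fintype.sum_equiv (Equiv.mulLeft g) _ _ fun z ↦ ?_).symm
    rw [Equiv.coe_mulLeft, hMinv, hMinv]
  let E := Module.End.eigenspace (M.conjTranspose * M).toEuclideanLin (μ : ℂ)
  have hE (g : G) : ∀ f ∈ E, leftTranslation G g f ∈ E := fun f hf ↦ by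
    rw [Module.End.mem_eigenspace_iff] at hf ⊢
    rw [leftTranslation_commute hPinv, hf, map_smul]
  refine hD E ((leftTranslation G).restrictInvariant E hE) fun htriv ↦ ?_
  obtain ⟨f, hf⟩ := heig.exists_hasEigenvector
  have hconst (x : G) : f x = f 1 := by
    have h1 := congr(($htriv x ⟨f, hf.1⟩ : EuclideanSpace ℂ G) x)
    have h2 : leftTranslation G x f x = f x := h1
    rw [← h2, leftTranslation_apply, inv_mul_cancel]
  have hMf : M.toEuclideanLin f = 0 := by
    ext x
    simp only [Matrix.toLpLin_apply, Matrix.mulVec, dotProduct, hconst, ← Finset.sum_mul]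
    have : ∑ y, M x y = ∑ z, b z :=
      Fintype.sum_equiv ((Equiv.inv G).trans (Equiv.mulRight x)) _ _ fun y ↦ rfl
    simp [this, hb]
  have hSf := hf.apply_eq_smul
  rw [Matrix.toLpLin_mul_same, LinearMap.comp_apply, hMf, map_zero] at hSf
  rcases smul_eq_zero.1 hSf.symm with h | h
  · exact hpos.ne' (by exact_mod_cast h)
  · exact hf.2 h

/-- Gowers' theorem on product sets in quasirandom groups. -/
theorem exists_mul_mul_eq_of_quasirandom {G : Type} [Group G] [Fintype G] {D : ℝ}
    (hD : ∀ (E : Type) [AddCommGroup E] [Module ℂ E] [FiniteDimensional ℂ E]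
      (ρ : Representation ℂ G E), ρ ≠ 1 → D ≤ Module.finrank ℂ E)
    (hDpos : 0 ≤ D) (A B C : Finset G) (hB : B.Nonempty)
    (h : (Fintype.card G : ℝ) ^ 3 ≤ D * (A.card * B.card * C.card)) (g : G) :
    ∃ a ∈ A, ∃ b ∈ B, ∃ c ∈ C, a * b * c = g := by
  classical
  by_contra! hg
  set N : ℝ := (Fintype.card G : ℝ) with hN
  have hNpos : 0 < N := by rw [hN]; exact_mod_cast Fintype.card_pos
  have hBpos : (0 : ℝ) < B.card := by exact_mod_cast hB.card_pos
  set β : ℝ := B.card / N with hβ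
  set b : G → ℂ := fun x ↦ (((if x ∈ B then 1 else 0) - β : ℝ) : ℂ) with hb
  have hsum : ∑ x, (if x ∈ B then (1 : ℝ) else 0) = B.card := by simp
  obtain ⟨μ, hμ0, hμD, hμ⟩ := convolution_norm_bound hD b (by
    rw [hb, ← Complex.ofReal_sum, Finset.sum_sub_distrib, hsum]
    simp [hβ, ← hN, mul_div_cancel₀ _ hNpos.ne'])
  have hnorm : ∑ x, ‖b x‖ ^ 2 = B.card - B.card * β := by
    have (x : G) : ‖b x‖ ^ 2 = (if x ∈ B then 1 else 0) * (1 - 2 * β) + β ^ 2 := by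
      rw [hb, Complex.norm_real, Real.norm_eq_abs, sq_abs]
      split_ifs <;> ring
    simp_rw [this]
    rw [Finset.sum_add_distrib, ← Finset.sum_mul, hsum]
    simp only [Finset.sum_const, Finset.card_univ, nsmul_eq_mul, ← hN, hβ]
    field_simp
    ring
  have hDμ : D * μ < N * B.card := by
    refine hμD.trans_lt ?_
    rw [hnorm]
    have : 0 < B.card * β := by positivity
    gcongr
    linarith
  let f : EuclideanSpace ℂ G := WithLp.toLp 2 fun x ↦ if x ∈ A then 1 else 0
  have hf : ‖f‖ ^ 2 = A.card := by
    rw [EuclideanSpace.norm_sq_eq]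
    have (x : G) : ‖f x‖ ^ 2 = if x ∈ A then (1 : ℝ) else 0 := by
      simp only [f]; split_ifs <;> simp
    simp [this]
  have hlow : (C.card : ℝ) * (A.card * β) ^ 2 ≤ μ * A.card := by
    refine le_trans ?_ ((hμ f).trans_eq (by rw [hf]))
    rw [EuclideanSpace.norm_sq_eq]
    have hC : (C.image fun c ↦ g * c⁻¹).card = C.card :=
      Finset.card_image_of_injective _ fun x y hxy ↦ by simpa using hxy
    rw [← hC, ← nsmul_eq_mul, ← Finset.sum_const]
    refine le_trans (Finset.sum_le_sum fun x hx ↦ ?_)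
      (Finset.sum_le_univ_sum_of_nonneg fun x ↦ by positivity)
    obtain ⟨c, hc, rfl⟩ := Finset.mem_image.1 hx
    have hval : (Matrix.of fun x y ↦ b (y⁻¹ * x)).toEuclideanLin f (g * c⁻¹) =
        ((-(A.card * β) : ℝ) : ℂ) := by
      have (y : G) : b (y⁻¹ * (g * c⁻¹)) * f y = if y ∈ A then (-β : ℂ) else 0 := by
        simp only [f]
        split_ifs with hy
        · have : y⁻¹ * (g * c⁻¹) ∉ B := fun hmem ↦ hg y hy _ hmem c hc (by group)
          simp [hb, this]
        · simp
      simp [Matrix.toLpLin_apply, Matrix.mulVec, dotProduct, this]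
    rw [hval, Complex.norm_real, Real.norm_eq_abs, sq_abs, neg_sq]
  have hApos : (0 : ℝ) < A.card := by
    rcases A.eq_empty_or_nonempty with rfl | hA
    · have : 0 < N ^ 3 := by positivity
      simp at h
      linarith
    · exact_mod_cast hA.card_pos
  have h1 : (C.card : ℝ) * A.card * β ^ 2 ≤ μ := by
    refine le_of_mul_le_mul_right ?_ hApos
    linarith
  have h2 : D * ((C.card : ℝ) * A.card * β ^ 2) < N * B.card :=
    (mul_le_mul_of_nonneg_left h1 hDpos).trans_lt hDμ
  rw [hβ, div_pow] at h2
  have h3 : D * (A.card * B.card * C.card) * (B.card / N ^ 2) < N * B.card := by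
    calc _ = D * ((C.card : ℝ) * A.card * (B.card ^ 2 / N ^ 2)) := by ring
      _ < _ := h2
  have h4 := mul_le_mul_of_nonneg_right h (show 0 ≤ (B.card : ℝ) / N ^ 2 by positivity)
  have h5 : N ^ 3 * (B.card / N ^ 2) = N * B.card := by field_simp
  linarith

lemma AddChar.exists_ne_zero_weight {W E : Type*} [AddCommGroup W] [Finite W] [AddCommGroup E]
    [Module ℂ E] (op : AddChar W (Module.End ℂ E)) (hop : op ≠ 1) :
    ∃ χ : AddChar W ℂ, χ ≠ 1 ∧ ∃ e : E, e ≠ 0 ∧ ∀ v, op v e = χ v • e := by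
  classical
  have := Fintype.ofFinite W
  by_contra! H
  let proj (χ : AddChar W ℂ) (e : E) : E := ∑ u, χ (-u) • op u e
  have hproj (χ : AddChar W ℂ) (e : E) (v : W) : op v (proj χ e) = χ v • proj χ e := by
    simp only [proj, map_sum, Finset.smul_sum, map_smul]
    refine Fintype.sum_equiv (Equiv.addLeft v) _ _ fun u ↦ ?_
    have hu : v + -(v + u) = -u := by abel
    rw [Equiv.coe_addLeft, smul_smul, ← AddChar.map_add_eq_mul, AddChar.map_add_eq_mul op,
      Module.End.mul_apply, hu]
  have hzero (χ : AddChar W ℂ) (hχ : χ ≠ 1) (e : E) : proj χ e = 0 := by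
    by_contra hne
    obtain ⟨v, hv⟩ := H χ hχ _ hne
    exact hv (hproj χ e v)
  have hsum (e : E) : ∑ χ, proj χ e = (Fintype.card W : ℂ) • e := by
    simp only [proj]
    rw [Finset.sum_comm]
    simp_rw [← Finset.sum_smul, AddChar.sum_apply_eq_ite, neg_eq_zero, ite_smul, zero_smul]
    simp
  refine hop (DFunLike.ext _ _ fun v ↦ LinearMap.ext fun e ↦ ?_)
  have hcard : (Fintype.card W : ℂ) ≠ 0 := by exact_mod_cast Fintype.card_ne_zero
  have he : (Fintype.card W : ℂ) • e = proj 1 e := by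
    rw [← hsum, Finset.sum_eq_single 1 (fun χ _ hχ ↦ hzero χ hχ e) (by simp)]
  refine smul_right_injective E hcard ?_
  change (Fintype.card W : ℂ) • op v e = (Fintype.card W : ℂ) • e
  rw [← map_smul, he, hproj]
  simp

lemma AddChar.linearIndependent_of_weights {W E κ : Type*} [AddCommGroup W] [Finite W]
    [AddCommGroup E] [Module ℂ E] (op : AddChar W (Module.End ℂ E)) (χ : κ → AddChar W ℂ)
    (hχ : Function.Injective χ) (e : κ → E) (he : ∀ k, e k ≠ 0)
    (hop : ∀ k v, op v (e k) = χ k v • e k) : LinearIndependent ℂ e := by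
  rw [linearIndependent_iff']
  intro s c hc k hk
  have hli := (AddChar.linearIndependent W ℂ).comp χ hχ
  rw [linearIndependent_iff'] at hli
  refine (smul_eq_zero.1 ((Module.forall_dual_apply_eq_zero_iff ℂ (c k • e k)).1 fun φ ↦ ?_)).resolve_right
    (he k)
  rw [map_smul]
  refine hli s (fun k ↦ c k • φ (e k)) (funext fun v ↦ ?_) k hk
  have h := congr(φ (op v $hc))
  simp only [map_sum, map_smul, hop, map_zero] at h
  rw [← Pi.zero_apply (M := fun _ : W ↦ ℂ) v] at h
  rw [← h]
  simp only [Finset.sum_apply, Pi.smul_apply, Function.comp_apply, smul_eq_mul]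
  exact Finset.sum_congr rfl fun k _ ↦ by ring

namespace Matrix.SpecialLinearGroup

variable {ι F : Type*} [DecidableEq ι] [Fintype ι] [Field F]

/-- The transvection `1 + v wᵀ`, where `w ⬝ᵥ v = 0`. -/
def rankOneTransvection (v w : ι → F) (h : w ⬝ᵥ v = 0) : SpecialLinearGroup ι F :=
  ⟨1 + vecMulVec v w, by
    rw [vecMulVec_eq Unit, det_one_add_replicateCol_mul_replicateRow, h, add_zero]⟩

/-- The unipotent group of matrices differing from the identity only in column `r`. The coordinate
`v r` is ignored. -/
def columnUnipotent (r : ι) (v : ι → F) : SpecialLinearGroup ι F :=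
  rankOneTransvection (v - v r • Pi.single r 1) (Pi.single r 1) (by simp)

lemma coe_columnUnipotent (r : ι) (v : ι → F) :
    (columnUnipotent r v : Matrix ι ι F) =
      1 + vecMulVec (v - v r • Pi.single r 1) (Pi.single r 1) := rfl

lemma columnUnipotent_zero (r : ι) : columnUnipotent r (0 : ι → F) = 1 :=
  Subtype.ext (by simp [coe_columnUnipotent])

lemma columnUnipotent_add (r : ι) (v w : ι → F) :
    columnUnipotent r (v + w) = columnUnipotent r v * columnUnipotent r w := by
  refine Subtype.ext ?_
  rw [coe_mul]
  simp only [coe_columnUnipotent, add_mul, mul_add, one_mul, mul_one, vecMulVec_mul_vecMulVec]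
  have : (Pi.single r 1 : ι → F) ⬝ᵥ (w - w r • Pi.single r 1) = 0 := by simp
  rw [this, zero_smul, vecMulVec_zero, add_zero, add_assoc, ← add_vecMulVec]
  congr 2
  ext k
  simp
  ring

lemma columnUnipotent_single_self (r : ι) (t : F) : columnUnipotent r (Pi.single r t) = 1 := by
  refine Subtype.ext ?_
  have : (Pi.single r t : ι → F) - t • Pi.single r 1 = 0 := by
    rw [← Pi.single_smul, smul_eq_mul, mul_one, sub_self]
  simp [coe_columnUnipotent, this]

lemma columnUnipotent_single {i r : ι} (h : i ≠ r) (t : F) :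
    columnUnipotent r (Pi.single i t) = transvection h t := by
  refine Subtype.ext ?_
  rw [coe_columnUnipotent, transvection_coe]
  ext k l
  rcases eq_or_ne k i with rfl | hk <;> rcases eq_or_ne l r with rfl | hl <;>
    simp_all [vecMulVec_apply, single_apply]
  all_goals grind

lemma mul_columnUnipotent (r : ι) (g : SpecialLinearGroup ι F) {a : F} (ha : a ≠ 0)
    (hcol : (g : Matrix ι ι F) *ᵥ Pi.single r 1 = a⁻¹ • Pi.single r 1)
    (hrow : Pi.single r 1 ᵥ* (g : Matrix ι ι F) = a⁻¹ • Pi.single r 1) (v : ι → F) :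
    g * columnUnipotent r v =
      columnUnipotent r (a • ((g : Matrix ι ι F) *ᵥ v)) * g := by
  refine Subtype.ext ?_
  have hr : ((g : Matrix ι ι F) *ᵥ v) r = a⁻¹ * v r := by
    have := congr($hrow ⬝ᵥ v)
    rwa [← dotProduct_mulVec, single_one_dotProduct, smul_dotProduct, single_one_dotProduct] at this
  rw [coe_mul, coe_mul, coe_columnUnipotent, coe_columnUnipotent, mul_add, add_mul, mul_vecMulVec,
    vecMulVec_mul, hrow, mul_one, one_mul]
  congr 1
  rw [mulVec_sub, mulVec_smul, hcol]
  ext k l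
  simp only [vecMulVec_apply, Pi.sub_apply, Pi.smul_apply, smul_eq_mul, hr]
  field_simp

lemma diag2n_eq_prod_transvection {i j : ι} (hij : i ≠ j) {c : F} (hc : c ≠ 0) :
    diag2n hij c hc = transvection hij c * transvection hij.symm (-c⁻¹) * transvection hij c *
      transvection hij (-1) * transvection hij.symm 1 * transvection hij (-1) := by
  refine Subtype.ext ?_
  have hdiag : (diag2n hij c hc : Matrix ι ι F) = 1 + single i i (c - 1) + single j j (c⁻¹ - 1) := by
    rw [diag2n_coe]
    ext k l
    simp only [diagonal_apply, add_apply, one_apply, single_apply]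
    grind
  rw [hdiag]
  simp only [coe_mul, transvection_coe, mul_add, add_mul, mul_one, one_mul, single_mul_single_same,
    single_mul_single_of_ne _ _ _ _ hij, single_mul_single_of_ne _ _ _ _ hij.symm,
    add_zero]
  ext k l
  simp only [add_apply, one_apply, single_apply]
  grind

theorem closure_transvections_eq_top [Nontrivial ι] {H : Subgroup (SpecialLinearGroup ι F)}
    (hH : ∀ (i j : ι) (hij : i ≠ j) (c : F), transvection hij c ∈ H) : H = ⊤ := by
  refine eq_top_iff.2 fun M _ ↦ diagonal_transvection_induction' (· ∈ H) M (fun i j hij c hc ↦ ?_)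
    hH fun _ _ ↦ mul_mem
  rw [diag2n_eq_prod_transvection]
  exact mul_mem (mul_mem (mul_mem (mul_mem (mul_mem (hH _ _ _ _) (hH _ _ _ _)) (hH _ _ _ _))
    (hH _ _ _ _)) (hH _ _ _ _)) (hH _ _ _ _)

/-- The operators of the column unipotent group in a representation, as an additive character. -/
def columnUnipotentChar {E : Type*} [AddCommGroup E] [Module ℂ E]
    (ρ : Representation ℂ (SpecialLinearGroup ι F) E) (r : ι) :
    AddChar (ι → F) (Module.End ℂ E) where
  toFun v := ρ (columnUnipotent r v)
  map_zero_eq_one' := by rw [columnUnipotent_zero, map_one]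
  map_add_eq_mul' v w := by rw [columnUnipotent_add, map_mul]

lemma columnUnipotentChar_apply {E : Type*} [AddCommGroup E] [Module ℂ E]
    (ρ : Representation ℂ (SpecialLinearGroup ι F) E) (r : ι) (v : ι → F) :
    columnUnipotentChar ρ r v = ρ (columnUnipotent r v) := rfl

/-- An element of the Levi subgroup normalizing the column unipotent group. -/
noncomputable def leviElement {i r : ι} (h : i ≠ r) (a : F) (ha : a ≠ 0) (w : ι → F)
    (hw : w i = 0) : SpecialLinearGroup ι F :=
  diag2n h a ha * rankOneTransvection (Pi.single i 1) w (by simpa using hw)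

lemma leviElement_mulVec {i r : ι} (h : i ≠ r) {a : F} (ha : a ≠ 0) {w : ι → F}
    (hw : w i = 0) (v : ι → F) :
    (leviElement h a ha w hw : Matrix ι ι F) *ᵥ v = fun k ↦
      (if k = i then a else if k = r then a⁻¹ else 1) * (v k + if k = i then w ⬝ᵥ v else 0) := by
  rw [leviElement, coe_mul, ← mulVec_mulVec]
  ext k
  rw [diag2n_coe, mulVec_diagonal]
  congr 1
  simp [rankOneTransvection, add_mulVec, vecMulVec_mulVec, Pi.single_apply]

lemma leviElement_mulVec_single_self {i r : ι} (h : i ≠ r) {a : F} (ha : a ≠ 0) {w : ι → F}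
    (hw : w i = 0) (hwr : w r = 0) :
    (leviElement h a ha w hw : Matrix ι ι F) *ᵥ Pi.single r 1 = a⁻¹ • Pi.single r 1 := by
  rw [leviElement_mulVec]
  ext k
  simp only [dotProduct_single_one, hwr, Pi.smul_apply, Pi.single_apply, smul_eq_mul]
  grind

lemma single_self_vecMul_leviElement {i r : ι} (h : i ≠ r) {a : F} (ha : a ≠ 0) {w : ι → F}
    (hw : w i = 0) :
    Pi.single r 1 ᵥ* (leviElement h a ha w hw : Matrix ι ι F) = a⁻¹ • Pi.single r 1 := by
  have hd : Pi.single r 1 ᵥ* (diag2n h a ha : Matrix ι ι F) = a⁻¹ • Pi.single r 1 := by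
    ext k
    rw [diag2n_coe, vecMul_diagonal]
    simp only [Pi.smul_apply, Pi.single_apply, smul_eq_mul]
    grind
  rw [leviElement, coe_mul, ← vecMul_vecMul, hd, smul_vecMul]
  simp [rankOneTransvection, vecMul_add, vecMul_vecMulVec, h]

lemma card_le_two_mul_card_image_sq [Fintype F] [DecidableEq F] :
    Fintype.card F - 1 ≤ 2 * ((Finset.univ.erase (0 : F)).image (· ^ 2)).card := by
  rw [← Finset.card_univ, ← Finset.card_erase_of_mem (Finset.mem_univ (0 : F))]
  refine Finset.card_le_mul_card_image _ _ fun b hb ↦ ?_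
  obtain ⟨a, -, rfl⟩ := Finset.mem_image.1 hb
  refine (Finset.card_le_card (t := {a, -a}) fun x hx ↦ ?_).trans Finset.card_le_two
  have := sq_eq_sq_iff_eq_or_eq_neg.1 (Finset.mem_filter.1 hx).2
  simpa using this

/-- Nontrivial complex representations of `SL` over a finite field have large dimension. -/
theorem card_pow_le_four_mul_finrank [Nontrivial ι] [Fintype F] {E : Type*} [AddCommGroup E]
    [Module ℂ E] [FiniteDimensional ℂ E] (ρ : Representation ℂ (SpecialLinearGroup ι F) E)
    (hρ : ρ ≠ 1) :
    Fintype.card F ^ (Fintype.card ι - 1) ≤ 4 * Module.finrank ℂ E := by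
  classical
  obtain ⟨i₀, r, hir₀, c, hc⟩ : ∃ (i j : ι) (hij : i ≠ j) (c : F), ρ (transvection hij c) ≠ 1 := by
    by_contra! H
    have := closure_transvections_eq_top (H := ρ.ker) H
    exact hρ (MonoidHom.ker_eq_top_iff.1 this)
  obtain ⟨χ, hχ, e, he, hχe⟩ := (columnUnipotentChar ρ r).exists_ne_zero_weight fun h ↦ hc <| by
    rw [← columnUnipotent_single hir₀ c, ← columnUnipotentChar_apply, h, AddChar.one_apply]
  obtain ⟨i, t₀, hi⟩ : ∃ i t, χ (Pi.single i t) ≠ 1 := by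
    by_contra! H
    refine hχ (DFunLike.ext _ _ fun v ↦ ?_)
    rw [AddChar.one_apply, ← Finset.univ_sum_single v]
    exact Finset.sum_induction _ (fun v ↦ χ v = 1)
      (fun x y hx hy ↦ by rw [AddChar.map_add_eq_mul, hx, hy, one_mul]) χ.map_zero_eq_one
      fun i _ ↦ H i _
  have hir : i ≠ r := by
    rintro rfl
    have := hχe (Pi.single i t₀)
    rw [columnUnipotentChar_apply, columnUnipotent_single_self, map_one,
      Module.End.one_apply] at this
    refine hi (smul_left_injective ℂ he ?_)
    simpa using this.symm
  let ψ : AddChar F ℂ := χ.compAddMonoidHom (AddMonoidHom.single (fun _ ↦ F) i)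
  have hψ (t : F) : ψ t = χ (Pi.single i t) := rfl
  have hψinj : Function.Injective (AddChar.mulShift ψ) :=
    AddChar.to_mulShift_inj_of_isPrimitive <| AddChar.IsPrimitive.of_ne_one fun h ↦ hi <| by
      rw [← hψ, h, AddChar.one_apply]
  let S : Finset F := (Finset.univ.erase 0).image (· ^ 2)
  let J : Finset ι := (Finset.univ.erase r).erase i
  have hroot (s : S) : ∃ a : F, a ≠ 0 ∧ a ^ 2 = s := by
    obtain ⟨a, ha, h⟩ := Finset.mem_image.1 s.2
    exact ⟨a, (Finset.mem_erase.1 ha).1, h⟩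
  choose a ha has using hroot
  let w (u : J → F) : ι → F := fun k ↦ if h : k ∈ J then u ⟨k, h⟩ else 0
  have hwi (u) : w u i = 0 := by simp [w, J]
  have hwr (u) : w u r = 0 := by simp [w, J]
  have hwJ (u) (j : J) : w u j = u j := by simp [w]
  let g (k : S × (J → F)) : SpecialLinearGroup ι F :=
    leviElement hir (a k.1) (ha k.1) (w k.2) (hwi _)
  let φ (k : S × (J → F)) : (ι → F) →+ (ι → F) :=
    (a k.1 • (g k : Matrix ι ι F).mulVecLin).toAddMonoidHom
  have hφ (k v) : φ k v = a k.1 • ((g k : Matrix ι ι F) *ᵥ v) := rfl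
  let X (k : S × (J → F)) : AddChar (ι → F) ℂ := χ.compAddMonoidHom (φ k)
  have hXi (k t) : X k (Pi.single i t) = ψ (k.1 * t) := by
    have : φ k (Pi.single i t) = Pi.single i (k.1 * t) := by
      rw [hφ, leviElement_mulVec]
      ext l
      simp only [Pi.smul_apply, dotProduct_single, hwi, Pi.single_apply, smul_eq_mul, ← has]
      grind
    rw [hψ, ← this]
    rfl
  have hXj (k t) (j : J) : X k (Pi.single (j : ι) t) =
      χ (Pi.single (j : ι) (a k.1 * t)) * ψ (k.1 * k.2 j * t) := by
    have hji : (j : ι) ≠ i := (Finset.mem_erase.1 j.2).1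
    have hjr : (j : ι) ≠ r := (Finset.mem_erase.1 (Finset.mem_erase.1 j.2).2).1
    have : φ k (Pi.single (j : ι) t) =
        Pi.single (j : ι) (a k.1 * t) + Pi.single i (k.1 * k.2 j * t) := by
      rw [hφ, leviElement_mulVec]
      ext l
      simp only [Pi.smul_apply, Pi.add_apply, dotProduct_single, hwJ, Pi.single_apply, smul_eq_mul,
        ← has]
      grind
    rw [hψ, ← AddChar.map_add_eq_mul, ← this]
    rfl
  have hXinj : Function.Injective X := by
    rintro ⟨s, u⟩ ⟨s', u'⟩ h
    have hs : s = s' := Subtype.ext <| hψinj <| DFunLike.ext _ _ fun t ↦ by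
      rw [AddChar.mulShift_apply, AddChar.mulShift_apply, ← hXi ⟨s, u⟩, h, hXi]
    subst hs
    have hs0 : (s : F) ≠ 0 := by rw [← has]; exact pow_ne_zero _ (ha s)
    have hu : u = u' := funext fun j ↦ mul_left_cancel₀ hs0 <| hψinj <| DFunLike.ext _ _ fun t ↦ by
      have hj := DFunLike.congr_fun h (Pi.single (j : ι) t)
      rw [hXj, hXj] at hj
      exact mul_left_cancel₀ (χ.val_isUnit _).ne_zero hj
    rw [hu]
  have hli := AddChar.linearIndependent_of_weights (columnUnipotentChar ρ r) X hXinj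
    (fun k ↦ ρ (g k)⁻¹ e)
    (fun k h ↦ he <| by
      have := congrArg (ρ (g k)) h
      rwa [← Module.End.mul_apply, ← map_mul, mul_inv_cancel, map_one, map_zero] at this)
    (fun k v ↦ by
      have hcomm : columnUnipotent r v * (g k)⁻¹ = (g k)⁻¹ * columnUnipotent r (φ k v) := by
        rw [mul_inv_eq_iff_eq_mul, mul_assoc, eq_inv_mul_iff_mul_eq, hφ]
        exact mul_columnUnipotent r (g k) (ha k.1)
          (leviElement_mulVec_single_self hir _ _ (hwr _)) (single_self_vecMul_leviElement hir _ _) v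
      rw [columnUnipotentChar_apply, ← Module.End.mul_apply, ← map_mul, hcomm, map_mul,
        Module.End.mul_apply, ← columnUnipotentChar_apply, hχe, map_smul]
      rfl)
  have hcard := hli.fintype_card_le_finrank
  rw [Fintype.card_prod, Fintype.card_fun, Fintype.card_coe, Fintype.card_coe] at hcard
  have hJ : J.card = Fintype.card ι - 2 := by
    rw [Finset.card_erase_of_mem (by simp [hir]), Finset.card_erase_of_mem (by simp),
      Finset.card_univ]
    omega
  have hS : Fintype.card F - 1 ≤ 2 * S.card := card_le_two_mul_card_image_sq
  have hq : 2 ≤ Fintype.card F := Fintype.one_lt_card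
  have hn : 2 ≤ Fintype.card ι := Fintype.one_lt_card
  rw [hJ] at hcard
  calc Fintype.card F ^ (Fintype.card ι - 1)
      = Fintype.card F * Fintype.card F ^ (Fintype.card ι - 2) := by
        rw [← pow_succ']
        congr 1
        omega
    _ ≤ (4 * S.card) * Fintype.card F ^ (Fintype.card ι - 2) := by gcongr; omega
    _ ≤ 4 * Module.finrank ℂ E := by rw [mul_assoc]; gcongr

end Matrix.SpecialLinearGroup

/-- For all `n ≥ 2` and all finite fields `F` of order `q`: any subset `A` of
`G = PSL(n,q)` of size at least `2|G| / q^((n-1)/3)` satisfies `A³ = G`. -/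
theorem PSL_large_subset_cube (n : ℕ) (hn : 2 ≤ n) (F : Type) [Field F] [Fintype F]
    (A : Set (Matrix.ProjectiveSpecialLinearGroup (Fin n) F))
    (hA : 2 * (Nat.card (Matrix.ProjectiveSpecialLinearGroup (Fin n) F) : ℝ) /
        (Fintype.card F : ℝ) ^ (((n : ℝ) - 1) / 3) ≤ (Nat.card ↥A : ℝ)) :
    A * A * A = Set.univ := by
  classical
  have : Nontrivial (Fin n) := Fin.nontrivial_iff_two_le.2 hn
  have : Finite (Matrix.ProjectiveSpecialLinearGroup (Fin n) F) :=
    Finite.of_surjective _ (QuotientGroup.mk'_surjective _)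
  let _ := Fintype.ofFinite (Matrix.ProjectiveSpecialLinearGroup (Fin n) F)
  have hq : (0 : ℝ) < Fintype.card F := by exact_mod_cast Fintype.card_pos
  have hs : (0 : ℝ) < (Fintype.card F : ℝ) ^ (((n : ℝ) - 1) / 3) := by positivity
  have hs3 : ((Fintype.card F : ℝ) ^ (((n : ℝ) - 1) / 3)) ^ 3 = (Fintype.card F : ℝ) ^ (n - 1) := by
    rw [← Real.rpow_natCast, ← Real.rpow_mul hq.le, ← Real.rpow_natCast]
    congr 1
    push_cast [Nat.cast_sub (by omega : 1 ≤ n)]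
    ring
  generalize (Fintype.card F : ℝ) ^ (((n : ℝ) - 1) / 3) = s at hA hs hs3
  have hN : (0 : ℝ) < Fintype.card (Matrix.ProjectiveSpecialLinearGroup (Fin n) F) := by
    exact_mod_cast Fintype.card_pos
  rw [Nat.card_eq_fintype_card, Nat.card_eq_card_toFinset, div_le_iff₀ hs] at hA
  have hAne : A.toFinset.Nonempty := by
    rw [← Finset.card_pos, Nat.pos_iff_ne_zero]
    intro h
    rw [h, Nat.cast_zero, zero_mul] at hA
    linarith
  have hD (E : Type) [AddCommGroup E] [Module ℂ E] [FiniteDimensional ℂ E]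
      (ρ : Representation ℂ (Matrix.ProjectiveSpecialLinearGroup (Fin n) F) E) (hρ : ρ ≠ 1) :
      (Fintype.card F : ℝ) ^ (n - 1) / 4 ≤ Module.finrank ℂ E := by
    have h := Matrix.SpecialLinearGroup.card_pow_le_four_mul_finrank
      (ρ.comp (QuotientGroup.mk' _)) fun h ↦ hρ <|
        (MonoidHom.cancel_right (QuotientGroup.mk'_surjective _)).1 h
    rw [Fintype.card_fin] at h
    rw [div_le_iff₀ four_pos, mul_comm]
    exact_mod_cast h
  have hcard : (Fintype.card (Matrix.ProjectiveSpecialLinearGroup (Fin n) F) : ℝ) ^ 3 ≤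
      (Fintype.card F : ℝ) ^ (n - 1) / 4 *
        (A.toFinset.card * A.toFinset.card * A.toFinset.card) := by
    rw [← hs3]
    have h := pow_le_pow_left₀ (by positivity) hA 3
    have := pow_pos hN 3
    nlinarith
  refine Set.eq_univ_of_forall fun g ↦ ?_
  obtain ⟨a, ha, b, hb, c, hc, rfl⟩ :=
    exists_mul_mul_eq_of_quasirandom hD (by positivity) _ _ _ hAne hcard g
  rw [Set.mem_toFinset] at ha hb hc
  exact Set.mul_mem_mul (Set.mul_mem_mul ha hb) hc
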